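/- arXiv:1311.6938 — 2 statements merged into one kernel-verified Lean document; each statement's English description precedes it below -/
import Mathlib

section
/- Let u(x,t) = u_0(x − t) with u_0 : ℝ → ℝ 2π-periodic and of class C^{2k+1}, let u_h be a DG solution on [0,T] with the periodic upwind flux, and suppose the initial value is u_h(·,0) = u_I^k(·,0) on Ω. Then there is a constant C depending only on k and the quasi-uniformity constant c such that for all t ∈ [0,T], | (1/(2π)) ∫_0^{2π} (u − u_h)(x,t) dx | ≤ C h^{2k+1} M_{2k+1}. -/
open MeasureTheory intervalIntegral

/-- Legendre polynomial of degree `m` via the Rodrigues formula. -/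
noncomputable def legendreP (m : ℕ) : ℝ → ℝ :=
  fun s => (1 / ((2:ℝ) ^ m * (Nat.factorial m : ℝ))) *
    iteratedDeriv m (fun t : ℝ => (t ^ 2 - 1) ^ m) s

/-- Legendre polynomial rescaled to the cell `(a, b)`. -/
noncomputable def legendreCell (m : ℕ) (a b : ℝ) : ℝ → ℝ :=
  fun x => legendreP m ((2 * x - (a + b)) / (b - a))

/-- `P` is the Gauss–Radau projection (onto polynomials of degree ≤ k on `(a,b)`) of `u`. -/
def IsGRProj (k : ℕ) (a b : ℝ) (u : ℝ → ℝ) (P : Polynomial ℝ) : Prop :=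
  P.natDegree ≤ k ∧
  (∀ v : Polynomial ℝ, v.natDegree + 1 ≤ k →
    (∫ x in a..b, P.eval x * v.eval x) = ∫ x in a..b, u x * v.eval x) ∧
  P.eval b = u b

/-- The scaled primitive `(D⁻¹ v)(x) = (2/(b-a)) ∫_a^x v`. -/
noncomputable def Dinv (a b : ℝ) (v : ℝ → ℝ) : ℝ → ℝ :=
  fun x => (2 / (b - a)) * ∫ t in a..x, v t

/-- `F` is the sequence of correction polynomials on the cell `(a,b)`:
`F 1 = P_h^-(D⁻¹ L_k)` and `F i = -P_h^-(D⁻¹ F (i-1))` for `i ≥ 2`. -/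
def IsFSeq (k : ℕ) (a b : ℝ) (F : ℕ → Polynomial ℝ) : Prop :=
  IsGRProj k a b (Dinv a b (legendreCell k a b)) (F 1) ∧
  ∀ i, 2 ≤ i → IsGRProj k a b (Dinv a b (fun x => (F (i-1)).eval x)) (-(F i))

/-- The `m`-th Radau coefficient of `w` on the cell `(a,b)`. -/
noncomputable def radauCoeff (a b : ℝ) (w : ℝ → ℝ) (m : ℕ) : ℝ :=
  w b - (1 / (b - a)) *
    ∫ x in a..b, w x * ∑ l ∈ Finset.range m, (2 * (l:ℝ) + 1) * legendreCell l a b x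

/-- `G_i(t) = (d/dt)^i u_{j,k+1}(t)` for `u(x,t) = u0(x - t)` on the cell `(a,b)`. -/
noncomputable def Gfun (k : ℕ) (a b : ℝ) (u0 : ℝ → ℝ) (i : ℕ) (t : ℝ) : ℝ :=
  iteratedDeriv i (fun s => radauCoeff a b (fun y => u0 (y - s)) (k + 1)) t

/-- `w_i(x,t) = (h_j/2)^i G_i(t) F_i(x)` on the cell `(a,b)`. -/
noncomputable def wFun (k : ℕ) (a b : ℝ) (u0 : ℝ → ℝ) (F : ℕ → Polynomial ℝ)
    (i : ℕ) (y t : ℝ) : ℝ :=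
  ((b - a) / 2) ^ i * Gfun k a b u0 i t * (F i).eval y

/-- `w^l = Σ_{i=1}^l w_i` on the cell `(a,b)`. -/
noncomputable def wSum (k : ℕ) (a b : ℝ) (u0 : ℝ → ℝ) (F : ℕ → Polynomial ℝ)
    (l : ℕ) (y t : ℝ) : ℝ :=
  ∑ i ∈ Finset.Icc 1 l, wFun k a b u0 F i y t

/-- The interpolation function `u_I^l = P_h^- u - w^l` on the cell `(a,b)`;
here `P t` is the Gauss–Radau projection of `u(·,t)`. -/
noncomputable def uIl (k : ℕ) (a b : ℝ) (u0 : ℝ → ℝ) (P : ℝ → Polynomial ℝ)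
    (F : ℕ → Polynomial ℝ) (l : ℕ) (y t : ℝ) : ℝ :=
  (P t).eval y - wSum k a b u0 F l y t

/-- `uh` is a DG solution on `[0,T]` on the mesh `x 0 < x 1 < … < x N`
(the piece on the cell `τ_j = (x (j-1), x j)` is the polynomial `uh j t`),
with prescribed inflow value `inflow t` at the left boundary. -/
def IsDGSol (k N : ℕ) (x : ℕ → ℝ) (T : ℝ) (inflow : ℝ → ℝ)
    (uh : ℕ → ℝ → Polynomial ℝ) : Prop :=
  (∀ j ∈ Finset.Icc 1 N, ∀ t : ℝ, (uh j t).natDegree ≤ k) ∧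
  (∀ j ∈ Finset.Icc 1 N, ∀ y : ℝ, ContDiff ℝ 1 (fun t => (uh j t).eval y)) ∧
  (∀ j ∈ Finset.Icc 1 N, ∀ t ∈ Set.Icc (0:ℝ) T, ∀ v : Polynomial ℝ, v.natDegree ≤ k →
    (∫ y in (x (j-1))..(x j), deriv (fun s => (uh j s).eval y) t * v.eval y)
      - (∫ y in (x (j-1))..(x j), (uh j t).eval y * v.derivative.eval y)
      + (uh j t).eval (x j) * v.eval (x j)
      - (if j = 1 then inflow t else (uh (j-1) t).eval (x (j-1))) * v.eval (x (j-1)) = 0)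

/-- The error `u - u_I^l` on the cell `τ_j`, as a function of `(y, s)`. -/
noncomputable def errFun (k l : ℕ) (x : ℕ → ℝ) (u0 : ℝ → ℝ)
    (P : ℕ → ℝ → Polynomial ℝ) (F : ℕ → ℕ → Polynomial ℝ) (j : ℕ) (y s : ℝ) : ℝ :=
  u0 (y - s) - uIl k (x (j-1)) (x j) u0 (P j) (F j) l y s

section PartOne
open Polynomial

/-- Legendre polynomial as an actual polynomial. -/
noncomputable def LP (m : ℕ) : ℝ[X] :=
  C (1 / ((2:ℝ) ^ m * (Nat.factorial m : ℝ))) * derivative^[m] ((X ^ 2 - 1) ^ m)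

lemma iteratedDeriv_poly (p : ℝ[X]) (m : ℕ) :
    iteratedDeriv m (fun t => p.eval t) = fun t => (derivative^[m] p).eval t := by
  induction m with
  | zero => simp
  | succ m ih =>
    rw [iteratedDeriv_succ, ih, Function.iterate_succ_apply']
    funext t
    simp

lemma legendreP_eq (m : ℕ) (s : ℝ) : legendreP m s = (LP m).eval s := by
  have h := iteratedDeriv_poly ((X ^ 2 - 1) ^ m) m
  simp only [eval_pow, eval_sub, eval_X, eval_one] at h
  simp only [legendreP, LP, h, eval_mul, eval_C]

lemma LP_eval_one (m : ℕ) : (LP m).eval 1 = 1 := by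
  have h := aeval_iterate_derivative_self (R := ℝ) (A := ℝ) ((X ^ 2 - 1) ^ m) m 1
    (p' := (X + 1) ^ m) (by simp [← mul_pow]; ring)
  simp only [coe_aeval_eq_eval] at h
  have h2 : ((2:ℝ) ^ m) ≠ 0 := by positivity
  have h3 : (Nat.factorial m : ℝ) ≠ 0 := by positivity
  simp only [LP, eval_mul, eval_C, h]
  simp
  norm_num
  field_simp

lemma LP_eval_neg_one (m : ℕ) : (LP m).eval (-1) = (-1) ^ m := by
  have h := aeval_iterate_derivative_self (R := ℝ) (A := ℝ) ((X ^ 2 - 1) ^ m) m (-1)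
    (p' := (X - 1) ^ m) (by simp [← mul_pow]; ring)
  simp only [coe_aeval_eq_eval] at h
  have h2 : ((2:ℝ) ^ m) ≠ 0 := by positivity
  have h3 : (Nat.factorial m : ℝ) ≠ 0 := by positivity
  simp only [LP, eval_mul, eval_C, h]
  simp
  have : (-1 - 1 : ℝ) = (-1) * 2 := by norm_num
  rw [this, mul_pow]
  field_simp

lemma by_parts_poly (p q : ℝ[X]) (a b : ℝ) :
    ∫ s in a..b, p.eval s * (derivative q).eval s =
      p.eval b * q.eval b - p.eval a * q.eval a - ∫ s in a..b, (derivative p).eval s * q.eval s := by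
  apply intervalIntegral.integral_mul_deriv_eq_deriv_mul
  · intro x _; exact p.hasDerivAt x
  · intro x _; exact q.hasDerivAt x
  · exact (derivative p).continuous.intervalIntegrable _ _
  · exact (derivative q).continuous.intervalIntegrable _ _

lemma ortho_aux (q : ℝ[X]) (n : ℕ) : ∀ p : ℝ[X], p.natDegree < n →
    (∀ i < n, (derivative^[i] q).eval 1 = 0 ∧ (derivative^[i] q).eval (-1) = 0) →
    ∫ s in (-1:ℝ)..1, p.eval s * (derivative^[n] q).eval s = 0 := by
  induction n with
  | zero => intro p hp; omega
  | succ n ih =>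
    intro p hp hq
    rw [Function.iterate_succ_apply', by_parts_poly, (hq n (by omega)).1, (hq n (by omega)).2]
    rcases Nat.eq_zero_or_pos p.natDegree with h0 | h0
    · rw [derivative_of_natDegree_zero h0]; simp
    · rw [ih (derivative p) (lt_of_lt_of_le (natDegree_derivative_lt (by omega)) (by omega))
        (fun i hi => hq i (by omega))]
      simp

lemma LP_ortho (m : ℕ) (p : ℝ[X]) (hp : p.natDegree < m) :
    ∫ s in (-1:ℝ)..1, p.eval s * (LP m).eval s = 0 := by
  have h := ortho_aux ((X ^ 2 - 1) ^ m) m p hp (by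
    intro i hi
    obtain ⟨r, hr⟩ := pow_sub_dvd_iterate_derivative_of_pow_dvd i (dvd_refl (((X:ℝ[X]) ^ 2 - 1) ^ m))
    have : m - i ≠ 0 := by omega
    rw [hr]; simp [this])
  simp only [LP, eval_mul, eval_C]
  calc _ = ∫ s in (-1:ℝ)..1, (1 / ((2:ℝ) ^ m * (Nat.factorial m : ℝ))) *
        (p.eval s * (derivative^[m] ((X ^ 2 - 1) ^ m)).eval s) := by congr 1; funext s; ring
    _ = 0 := by rw [intervalIntegral.integral_const_mul, h, mul_zero]

lemma LP_rec (n : ℕ) : derivative (LP (n+2)) = C (2*(n:ℝ)+3) * LP (n+1) + derivative (LP n) := by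
  have h2 : derivative^[2] (((X:ℝ[X]) ^ 2 - 1) ^ (n+2)) =
      C (2*((n:ℝ)+2)*(2*n+3)) * (X^2-1)^(n+1) + C (2*((n:ℝ)+2)*(2*(n+1))) * (X^2-1)^n := by
    simp [derivative_pow]
    simp only [map_ofNat]
    ring
  unfold LP
  rw [derivative_C_mul, derivative_C_mul, ← Function.iterate_succ_apply' derivative,
    ← Function.iterate_succ_apply' derivative, show (n+2).succ = (n+1) + 2 by omega, Function.iterate_add_apply,
    h2, iterate_map_add, iterate_derivative_C_mul, iterate_derivative_C_mul, mul_add,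
    ← mul_assoc (C _) (C _), ← mul_assoc (C _) (C _), ← mul_assoc (C _) (C _),
    ← C_mul, ← C_mul, ← C_mul]
  congr 2
  · congr 1
    rw [Nat.factorial_succ (n+1)]
    have : (Nat.factorial (n+1) : ℝ) ≠ 0 := by positivity
    push_cast
    field_simp
    ring
  · congr 1
    rw [Nat.factorial_succ (n+1), Nat.factorial_succ n]
    have : (Nat.factorial n : ℝ) ≠ 0 := by positivity
    push_cast
    field_simp
    ring

lemma LP_zero : LP 0 = 1 := by simp [LP]

lemma LP_one : LP 1 = X := by
  have h : (C 2⁻¹ * (1 + 1) : ℝ[X]) = 1 := by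
    rw [← C_1, ← C_add, ← C_mul]; norm_num
  simp [LP, ← mul_assoc]
  exact h

lemma KP_eq (k : ℕ) : ∑ l ∈ Finset.range (k+1), C (2*(l:ℝ)+1) * LP l =
    derivative (LP (k+1)) + derivative (LP k) := by
  induction k with
  | zero => simp [LP_zero, LP_one]
  | succ k ih =>
    rw [Finset.sum_range_succ, ih, LP_rec]
    push_cast
    rw [show 2*((k:ℝ)+1)+1 = 2*k+3 by ring]
    ring

lemma natDegree_LP (m : ℕ) : (LP m).natDegree ≤ m := by
  unfold LP
  refine (natDegree_C_mul_le _ _).trans ((natDegree_iterate_derivative _ _).trans ?_)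
  have : ((X ^ 2 - 1 : ℝ[X]) ^ m).natDegree ≤ m * 2 := by
    refine natDegree_pow_le.trans (Nat.mul_le_mul_left _ ?_)
    compute_degree
  omega

lemma kernel_ref (k : ℕ) (p : ℝ[X]) (hp : p.natDegree ≤ k) :
    ∫ s in (-1:ℝ)..1, p.eval s * ∑ l ∈ Finset.range (k+1), (2*(l:ℝ)+1) * (LP l).eval s
      = 2 * p.eval 1 := by
  have h : ∀ s : ℝ, ∑ l ∈ Finset.range (k+1), (2*(l:ℝ)+1) * (LP l).eval s =
      (derivative (LP (k+1) + LP k)).eval s := by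
    intro s
    rw [derivative_add, ← KP_eq, eval_finsetSum]
    simp
  simp_rw [h]
  rw [by_parts_poly]
  have h0 : ∫ s in (-1:ℝ)..1, (derivative p).eval s * (LP (k+1) + LP k).eval s = 0 := by
    rcases Nat.eq_zero_or_pos p.natDegree with h0 | h0
    · rw [derivative_of_natDegree_zero h0]; simp
    have hd := natDegree_derivative_lt (p := p) (by omega)
    simp only [eval_add, mul_add]
    rw [intervalIntegral.integral_add, LP_ortho _ _ (by omega), LP_ortho _ _ (by omega), add_zero]
    · exact ((derivative p).continuous.mul (LP (k+1)).continuous).intervalIntegrable _ _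
    · exact ((derivative p).continuous.mul (LP k).continuous).intervalIntegrable _ _
  rw [h0]
  simp only [eval_add, LP_eval_one, LP_eval_neg_one]
  ring

/-- change of variables to the reference cell -/
lemma cell_subst (a b : ℝ) (hab : a < b) (p : ℝ[X]) (g : ℝ → ℝ) :
    ∫ x in a..b, p.eval x * g ((2 * x - (a + b)) / (b - a)) =
      (b - a) / 2 * ∫ s in (-1:ℝ)..1,
        (p.comp (C ((b-a)/2) * X + C ((a+b)/2))).eval s * g s := by
  have hne : b - a ≠ 0 := by linarith
  have h := intervalIntegral.integral_comp_mul_add (a := a) (b := b) (fun s => 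
    (p.comp (C ((b-a)/2) * X + C ((a+b)/2))).eval s * g s) (c := 2/(b-a)) (by positivity)
    (-(a+b)/(b-a))
  have e1 : 2/(b-a)*a + -(a+b)/(b-a) = -1 := by field_simp; ring
  have e2 : 2/(b-a)*b + -(a+b)/(b-a) = 1 := by field_simp; ring
  rw [e1, e2] at h
  have e3 : (2/(b-a))⁻¹ = (b-a)/2 := by rw [inv_div]
  rw [e3, smul_eq_mul] at h
  rw [← h]
  congr 1
  funext x
  simp only [eval_comp, eval_add, eval_mul, eval_C, eval_X]
  congr 2
  · field_simp; ring
  · field_simp; ring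

lemma comp_deg (p : ℝ[X]) (c d : ℝ) : (p.comp (C c * X + C d)).natDegree ≤ p.natDegree := by
  rw [natDegree_comp]
  have : (C c * X + C d : ℝ[X]).natDegree ≤ 1 := natDegree_linear_le
  nlinarith

lemma legendreCell_ortho (k : ℕ) (a b : ℝ) (hab : a < b) (p : ℝ[X]) (hp : p.natDegree < k) :
    ∫ x in a..b, p.eval x * legendreCell k a b x = 0 := by
  unfold legendreCell
  simp_rw [legendreP_eq]
  rw [cell_subst a b hab p (fun s => (LP k).eval s),
    LP_ortho k _ (lt_of_le_of_lt (comp_deg _ _ _) hp), mul_zero]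

lemma kernel_cell (k : ℕ) (a b : ℝ) (hab : a < b) (p : ℝ[X]) (hp : p.natDegree ≤ k) :
    ∫ x in a..b, p.eval x * ∑ l ∈ Finset.range (k+1), (2*(l:ℝ)+1) * legendreCell l a b x
      = (b - a) * p.eval b := by
  unfold legendreCell
  simp_rw [legendreP_eq]
  rw [cell_subst a b hab p (fun s => ∑ l ∈ Finset.range (k+1), (2*(l:ℝ)+1) * (LP l).eval s),
    kernel_ref k _ ((comp_deg _ _ _).trans hp)]
  simp only [eval_comp, eval_add, eval_mul, eval_C, eval_X]
  rw [show (b-a)/2*1 + (a+b)/2 = b by ring]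
  ring

lemma legendreCell_cont (k : ℕ) (a b : ℝ) : Continuous (legendreCell k a b) := by
  unfold legendreCell
  simp_rw [legendreP_eq]
  apply (LP k).continuous.comp
  fun_prop

lemma LP_bound (k : ℕ) : ∃ B : ℝ, 1 ≤ B ∧ ∀ a b : ℝ, a < b → ∀ x ∈ Set.Icc a b,
    |legendreCell k a b x| ≤ B := by
  obtain ⟨B, hB⟩ := isCompact_Icc.exists_bound_of_continuousOn
    (s := Set.Icc (-1:ℝ) 1) (f := fun s => (LP k).eval s) (LP k).continuous.continuousOn
  refine ⟨max B 1, le_max_right _ _, fun a b hab x hx => ?_⟩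
  unfold legendreCell
  rw [legendreP_eq]
  refine (hB _ ?_).trans (le_max_left _ _)
  have : 0 < b - a := by linarith
  constructor
  · rw [le_div_iff₀ this]; linarith [hx.1]
  · rw [div_le_iff₀ this]; linarith [hx.2]

lemma KP_bound (k : ℕ) : ∃ B : ℝ, 1 ≤ B ∧ ∀ a b : ℝ, a < b → ∀ x ∈ Set.Icc a b,
    |∑ l ∈ Finset.range (k+1), (2*(l:ℝ)+1) * legendreCell l a b x| ≤ B := by
  choose B hB1 hB using LP_bound
  refine ⟨∑ l ∈ Finset.range (k+1), (2*(l:ℝ)+1) * B l, ?_, fun a b hab x hx => ?_⟩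
  · calc (1:ℝ) ≤ (2*((0:ℕ):ℝ)+1) * B 0 := by simpa using hB1 0
      _ ≤ _ := Finset.single_le_sum (f := fun l : ℕ => (2*(l:ℝ)+1) * B l)
          (fun i _ => mul_nonneg (by positivity) (by linarith [hB1 i])) (by simp)
  · refine (Finset.abs_sum_le_sum_abs _ _).trans (Finset.sum_le_sum fun l _ => ?_)
    rw [abs_mul, abs_of_nonneg (by positivity : (0:ℝ) ≤ 2*(l:ℝ)+1)]
    exact mul_le_mul_of_nonneg_left (hB l a b hab x hx) (by positivity)

end PartOne

section PartTwo
open Polynomial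

lemma Dinv_moment (a b : ℝ) (f : ℝ → ℝ) (hf : Continuous f) (m : ℕ) :
    ∫ x in a..b, Dinv a b f x * (b - x) ^ m =
      (2/(b-a)) * (1/((m:ℝ)+1)) * ∫ x in a..b, f x * (b - x) ^ (m+1) := by
  have hm : (m:ℝ) + 1 ≠ 0 := by positivity
  have h := intervalIntegral.integral_mul_deriv_eq_deriv_mul (a := a) (b := b)
    (u := Dinv a b f) (u' := fun x => 2/(b-a) * f x)
    (v := fun x => -((b-x)^(m+1) / ((m:ℝ)+1))) (v' := fun x => (b-x)^m)
    (by
      intro x _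
      unfold Dinv
      exact (intervalIntegral.integral_hasDerivAt_right (hf.intervalIntegrable _ _)
        hf.aestronglyMeasurable.stronglyMeasurableAtFilter hf.continuousAt).const_mul _)
    (by
      intro x _
      have h1 := ((((hasDerivAt_id x).const_sub b).pow (m+1)).div_const ((m:ℝ)+1)).neg
      refine h1.congr_deriv ?_
      simp
      field_simp)
    ((continuous_const.mul hf).intervalIntegrable _ _)
    ((by fun_prop : Continuous fun x : ℝ => (b-x)^m).intervalIntegrable _ _)
  rw [h]
  have h0 : Dinv a b f a = 0 := by simp [Dinv]
  rw [h0, ← intervalIntegral.integral_const_mul]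
  simp only [sub_self, ne_eq, Nat.add_eq_zero_iff, one_ne_zero, and_false, not_false_eq_true,
    zero_pow, zero_div, neg_zero, mul_zero, zero_mul, zero_sub]
  rw [← intervalIntegral.integral_neg]
  congr 1
  funext x
  field_simp

lemma grproj_moment (k : ℕ) (a b : ℝ) (f : ℝ → ℝ) (P : ℝ[X]) (h : IsGRProj k a b f P)
    (m : ℕ) (hm : m + 1 ≤ k) :
    ∫ x in a..b, P.eval x * (b - x) ^ m = ∫ x in a..b, f x * (b - x) ^ m := by
  have hd : ((C b - X : ℝ[X]) ^ m).natDegree ≤ m := by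
    refine natDegree_pow_le.trans ?_
    have : (C b - X : ℝ[X]).natDegree ≤ 1 := by compute_degree
    nlinarith
  have := h.2.1 ((C b - X) ^ m) (by omega)
  simpa using this

lemma F_moment (k : ℕ) (a b : ℝ) (F : ℕ → ℝ[X]) (hF : IsFSeq k a b F) (i : ℕ) :
    ∀ m : ℕ, m + (i+1) ≤ k → ∃ γ : ℝ, |γ| ≤ 1 ∧
      ∫ x in a..b, (F (i+1)).eval x * (b - x) ^ m =
        (2/(b-a))^(i+1) * γ * ∫ x in a..b, legendreCell k a b x * (b - x) ^ (m+(i+1)) := by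
  have hg : ∀ m : ℕ, |1/((m:ℝ)+1)| ≤ 1 := by
    intro m
    rw [abs_of_nonneg (by positivity), div_le_one (by positivity)]
    linarith [(Nat.cast_nonneg m : (0:ℝ) ≤ m)]
  induction i with
  | zero =>
    intro m hm
    refine ⟨1/((m:ℝ)+1), hg m, ?_⟩
    rw [grproj_moment k a b _ _ hF.1 m (by omega), Dinv_moment _ _ _ (legendreCell_cont k a b)]
    simp
  | succ i ih =>
    intro m hm
    obtain ⟨γ, hγ, e⟩ := ih (m+1) (by omega)
    refine ⟨-(1/((m:ℝ)+1) * γ), ?_, ?_⟩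
    · rw [abs_neg, abs_mul]
      exact mul_le_one₀ (hg m) (abs_nonneg _) hγ
    · have h1 := grproj_moment k a b _ _ (hF.2 (i+1+1) (by omega)) m (by omega)
      rw [Dinv_moment _ _ _ (F (i+1+1-1)).continuous] at h1
      rw [show i+1+1-1 = i+1 by omega, e] at h1
      simp only [eval_neg, neg_mul, intervalIntegral.integral_neg] at h1
      rw [show m + (i+1+1) = m+1+(i+1) by omega]
      have h2 := congrArg Neg.neg h1
      rw [neg_neg] at h2
      rw [h2]
      ring

lemma leg_mom_zero (k : ℕ) (a b : ℝ) (hab : a < b) (m : ℕ) (hm : m < k) :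
    ∫ x in a..b, legendreCell k a b x * (b - x) ^ m = 0 := by
  have hd : ((C b - X : ℝ[X]) ^ m).natDegree ≤ m := by
    refine natDegree_pow_le.trans ?_
    have : (C b - X : ℝ[X]).natDegree ≤ 1 := by compute_degree
    nlinarith
  have := legendreCell_ortho k a b hab ((C b - X) ^ m) (by omega)
  simpa [mul_comm] using this

lemma F_mean_zero (k : ℕ) (a b : ℝ) (hab : a < b) (F : ℕ → ℝ[X]) (hF : IsFSeq k a b F)
    (i : ℕ) (h1 : 1 ≤ i) (h2 : i < k) : ∫ x in a..b, (F i).eval x = 0 := by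
  obtain ⟨i, rfl⟩ : ∃ j, i = j + 1 := ⟨i-1, by omega⟩
  obtain ⟨γ, -, e⟩ := F_moment k a b F hF i 0 (by omega)
  rw [leg_mom_zero k a b hab _ (by omega)] at e
  simpa using e

lemma F_mean_bound (k : ℕ) (hk : 1 ≤ k) (a b : ℝ) (hab : a < b) (F : ℕ → ℝ[X])
    (hF : IsFSeq k a b F) (B : ℝ) (hB : ∀ x ∈ Set.Icc a b, |legendreCell k a b x| ≤ B) :
    |((b-a)/2)^k * ∫ x in a..b, (F k).eval x| ≤ B * (b-a)^k * (b-a) := by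
  obtain ⟨i, rfl⟩ : ∃ j, k = j + 1 := ⟨k-1, by omega⟩
  obtain ⟨γ, hγ, e⟩ := F_moment (i+1) a b F hF i 0 (by omega)
  simp only [pow_zero, mul_one, zero_add] at e
  have hpos : 0 < b - a := by linarith
  have e2 : ((b-a)/2)^(i+1) * (2/(b-a))^(i+1) = 1 := by
    rw [← mul_pow]
    rw [show (b-a)/2*(2/(b-a)) = 1 by field_simp, one_pow]
  rw [e, ← mul_assoc, ← mul_assoc, e2, one_mul, abs_mul]
  have hI : |∫ x in a..b, legendreCell (i+1) a b x * (b - x) ^ (i+1)| ≤ B * (b-a)^(i+1) * (b-a) := by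
    have := intervalIntegral.norm_integral_le_of_norm_le_const (a := a) (b := b)
      (f := fun x => legendreCell (i+1) a b x * (b - x) ^ (i+1)) (C := B * (b-a)^(i+1)) (by
        intro x hx
        rw [Set.uIoc_of_le hab.le] at hx
        have hxi : x ∈ Set.Icc a b := ⟨hx.1.le, hx.2⟩
        rw [Real.norm_eq_abs, abs_mul, abs_of_nonneg
          (pow_nonneg (by linarith [hx.2]) _ : (0:ℝ) ≤ (b-x)^(i+1))]
        have := hB x hxi
        refine mul_le_mul this (pow_le_pow_left₀ (by linarith [hx.2]) (by linarith [hx.1]) _)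
          (pow_nonneg (by linarith [hx.2]) _) ((abs_nonneg _).trans this))
    rwa [abs_of_pos hpos] at this
  calc _ ≤ 1 * |∫ x in a..b, legendreCell (i+1) a b x * (b - x) ^ (i+1)| :=
        mul_le_mul_of_nonneg_right hγ (abs_nonneg _)
    _ ≤ _ := by rw [one_mul]; exact hI

lemma hasDerivAt_shift_integral (f : ℝ → ℝ) (hf : ContDiff ℝ 1 f) (S : ℝ → ℝ)
    (hS : Continuous S) (a b s : ℝ) :
    HasDerivAt (fun s => ∫ y in a..b, f (y - s) * S y) (-∫ y in a..b, deriv f (y - s) * S y) s := by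
  have hfc := hf.continuous
  have hdc : Continuous (deriv f) := hf.continuous_deriv (le_refl _)
  have hcont : Continuous fun p : ℝ × ℝ => -(deriv f (p.2 - p.1) * S p.2) := by fun_prop
  obtain ⟨B, hB⟩ := (isCompact_Icc.prod isCompact_uIcc).exists_bound_of_continuousOn
    (s := Set.Icc (s-1) (s+1) ×ˢ Set.uIcc a b) hcont.continuousOn
  have := intervalIntegral.hasDerivAt_integral_of_dominated_loc_of_deriv_le
    (μ := volume) (a := a) (b := b) (F := fun s y => f (y - s) * S y)
    (F' := fun s y => -(deriv f (y - s) * S y)) (x₀ := s) (s := Set.Icc (s-1) (s+1))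
    (bound := fun _ => B) (Icc_mem_nhds (by linarith) (by linarith))
    (Filter.Eventually.of_forall fun x => Continuous.aestronglyMeasurable (by fun_prop))
    (Continuous.intervalIntegrable (by fun_prop) _ _)
    (Continuous.aestronglyMeasurable (by fun_prop))
    (Filter.Eventually.of_forall fun y hy x hx => hB (x, y) ⟨hx, Set.uIoc_subset_uIcc hy⟩)
    intervalIntegrable_const
    (Filter.Eventually.of_forall fun y hy x hx => by
      have h1 : HasDerivAt f (deriv f (y - x)) (y - x) :=
        (hf.differentiable (by simp) _).hasDerivAt
      have h2 := (h1.comp x ((hasDerivAt_id x).const_sub y)).mul_const (S y)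
      refine h2.congr_deriv ?_
      ring)
  have h2 := this.2
  rw [intervalIntegral.integral_neg] at h2
  exact h2

lemma radau_iter (a b : ℝ) (m n : ℕ) (u0 : ℝ → ℝ) (hu : ContDiff ℝ n u0) (i : ℕ) (hi : i ≤ n) :
    iteratedDeriv i (fun s => radauCoeff a b (fun y => u0 (y - s)) m) =
      fun s => (-1)^i * radauCoeff a b (fun y => iteratedDeriv i u0 (y - s)) m := by
  induction i with
  | zero => simp
  | succ i ih =>
    rw [iteratedDeriv_succ, ih (by omega)]
    funext s
    have hc : ContDiff ℝ 1 (iteratedDeriv i u0) := by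
      rw [iteratedDeriv_eq_iterate]
      refine ContDiff.iterate_deriv' 1 i ?_
      rw [add_comm]
      exact hu.of_le (by exact_mod_cast (by omega : i + 1 ≤ n) )
    have hS : Continuous fun x => ∑ l ∈ Finset.range m, (2 * (l:ℝ) + 1) * legendreCell l a b x :=
      continuous_finsetSum _ fun l _ => continuous_const.mul (legendreCell_cont l a b)
    have h1 := hasDerivAt_shift_integral _ hc _ hS a b s
    have h0 : HasDerivAt (iteratedDeriv i u0) (deriv (iteratedDeriv i u0) (b - s)) (b - s) :=
        (hc.differentiable (by simp) _).hasDerivAt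
    have h2 := h0.comp s ((hasDerivAt_id s).const_sub b)
    have h3 := (h2.sub (h1.const_mul (1/(b-a)))).const_mul ((-1:ℝ)^i)
    have h4 := h3.deriv
    unfold radauCoeff
    refine Eq.trans h4 ?_
    simp only [iteratedDeriv_succ]
    ring

lemma radau_bound (k : ℕ) (a b : ℝ) (hab : a < b) (w : ℝ → ℝ) (hw : ContDiff ℝ (k+1) w) (M : ℝ)
    (hM : ∀ y ∈ Set.Icc a b, |iteratedDeriv (k+1) w y| ≤ M) (B : ℝ)
    (hB : ∀ x ∈ Set.Icc a b,
      |∑ l ∈ Finset.range (k+1), (2*(l:ℝ)+1) * legendreCell l a b x| ≤ B) :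
    |radauCoeff a b w (k+1)| ≤ (1 + B) * (M * (b-a)^(k+1)) := by
  set S := fun x => ∑ l ∈ Finset.range (k+1), (2*(l:ℝ)+1) * legendreCell l a b x with hSdef
  have hS : Continuous S :=
      continuous_finsetSum _ fun l _ => continuous_const.mul (legendreCell_cont l a b)
  have hpos : 0 < b - a := by linarith
  have hM0 : 0 ≤ M := (abs_nonneg _).trans (hM a ⟨le_refl _, hab.le⟩)
  have hB0 : 0 ≤ B := (abs_nonneg _).trans (hB a ⟨le_refl _, hab.le⟩)
  obtain ⟨p, hpd, hp⟩ : ∃ p : ℝ[X], p.natDegree ≤ k ∧ ∀ x ∈ Set.Icc a b,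
      |w x - p.eval x| ≤ M * (b-a)^(k+1) := by
    refine ⟨∑ i ∈ Finset.range (k+1), C ((Nat.factorial i : ℝ)⁻¹ *
      iteratedDerivWithin i w (Set.Icc a b) a) * (X - C a)^i, ?_, ?_⟩
    · refine natDegree_sum_le_of_forall_le _ _ fun i hi => ?_
      rw [Finset.mem_range] at hi
      refine (natDegree_C_mul_le _ _).trans (natDegree_pow_le.trans ?_)
      rw [natDegree_X_sub_C]; omega
    · intro x hx
      have := taylor_mean_remainder_bound (C := M) (n := k) hab.le hw.contDiffOn hx (by
        intro y hy
        rw [iteratedDerivWithin_eq_iteratedDeriv (uniqueDiffOn_Icc hab)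
          (by exact_mod_cast hw.contDiffAt) hy]
        exact hM y hy)
      rw [taylor_within_apply, Real.norm_eq_abs] at this
      have e : (∑ i ∈ Finset.range (k+1), C ((Nat.factorial i : ℝ)⁻¹ *
          iteratedDerivWithin i w (Set.Icc a b) a) * (X - C a)^i).eval x = 
          ∑ i ∈ Finset.range (k + 1), ((Nat.factorial i : ℝ)⁻¹ * (x - a) ^ i) •
            iteratedDerivWithin i w (Set.Icc a b) a := by
        rw [eval_finsetSum]
        refine Finset.sum_congr rfl fun i _ => ?_
        simp
        ring
      rw [e]
      refine this.trans ((div_le_self (mul_nonneg hM0 (pow_nonneg (by linarith [hx.1]) _)) ?_).trans ?_)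
      · exact_mod_cast Nat.factorial_pos k
      · exact mul_le_mul_of_nonneg_left
          (pow_le_pow_left₀ (by linarith [hx.1]) (by linarith [hx.2]) _) hM0
  set R := M * (b-a)^(k+1) with hR
  have hR0 : 0 ≤ R := by positivity
  have hker := kernel_cell k a b hab p hpd
  have e : radauCoeff a b w (k+1) = (w b - p.eval b) -
      (1/(b-a)) * ∫ x in a..b, (w x - p.eval x) * S x := by
    have : ∫ x in a..b, (w x - p.eval x) * S x = (∫ x in a..b, w x * S x) - (b-a) * p.eval b := by
      rw [← hker]
      simp only [sub_mul]
      rw [intervalIntegral.integral_sub]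
      · exact (hw.continuous.mul hS).intervalIntegrable _ _
      · exact (p.continuous.mul hS).intervalIntegrable _ _
    rw [this]
    unfold radauCoeff
    field_simp
    ring
  have hI : |∫ x in a..b, (w x - p.eval x) * S x| ≤ (R * B) * (b-a) := by
    have := intervalIntegral.norm_integral_le_of_norm_le_const (a := a) (b := b)
      (f := fun x => (w x - p.eval x) * S x) (C := R * B) (by
        intro x hx
        rw [Set.uIoc_of_le hab.le] at hx
        have hxi : x ∈ Set.Icc a b := ⟨hx.1.le, hx.2⟩
        rw [Real.norm_eq_abs, abs_mul]
        exact mul_le_mul (hp x hxi) (hB x hxi) (abs_nonneg _) hR0)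
    rwa [abs_of_pos hpos] at this
  rw [e]
  refine (abs_sub _ _).trans ?_
  rw [abs_mul, abs_of_pos (by positivity : 0 < 1/(b-a))]
  have h1 := hp b ⟨hab.le, le_refl _⟩
  have h2 : 1/(b-a) * |∫ x in a..b, (w x - p.eval x) * S x| ≤ 1/(b-a) * ((R * B) * (b-a)) :=
    mul_le_mul_of_nonneg_left hI (by positivity)
  have h3 : 1/(b-a) * ((R * B) * (b-a)) = R * B := by field_simp
  linarith

end PartTwo

section PartThree
open Polynomial

lemma telescope_Icc (e : ℕ → ℝ) (N : ℕ) :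
    ∑ j ∈ Finset.Icc 1 N, (e j - e (j-1)) = e N - e 0 := by
  induction N with
  | zero => simp
  | succ N ih =>
    rw [Finset.sum_Icc_succ_top (by omega), ih, Nat.add_sub_cancel]
    ring

lemma poly_integral_deriv (k : ℕ) (p : ℝ → ℝ[X]) (hd : ∀ t, (p t).natDegree ≤ k)
    (hp : ∀ y : ℝ, ContDiff ℝ 1 (fun t => (p t).eval y)) (a b t : ℝ) :
    HasDerivAt (fun t => ∫ y in a..b, (p t).eval y)
      (∫ y in a..b, deriv (fun s => (p s).eval y) t) t := by
  have hinj : Set.InjOn (fun i : ℕ => (i:ℝ)) (Finset.range (k+1) : Set ℕ) :=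
    fun i _ j _ h => Nat.cast_injective h
  have hrep : ∀ t y, (p t).eval y = ∑ i ∈ Finset.range (k+1),
      (p t).eval (i:ℝ) * (Lagrange.basis (Finset.range (k+1)) (fun i : ℕ => (i:ℝ)) i).eval y := by
    intro t y
    have h := Lagrange.eq_interpolate (f := p t) hinj (by
      rw [Finset.card_range]
      exact lt_of_le_of_lt degree_le_natDegree (by exact_mod_cast Nat.lt_succ_of_le (hd t)))
    conv_lhs => rw [h]
    rw [Lagrange.interpolate_apply, eval_finsetSum]
    simp
  have hdi : ∀ y : ℝ, HasDerivAt (fun t => (p t).eval y) (deriv (fun t => (p t).eval y) t) t :=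
    fun y => ((hp y).differentiable (by simp) _).hasDerivAt
  have hder : ∀ y, deriv (fun s => (p s).eval y) t = ∑ i ∈ Finset.range (k+1),
      deriv (fun s => (p s).eval (i:ℝ)) t *
        (Lagrange.basis (Finset.range (k+1)) (fun i : ℕ => (i:ℝ)) i).eval y := by
    intro y
    have : (fun s => (p s).eval y) = fun s => ∑ i ∈ Finset.range (k+1),
      (p s).eval (i:ℝ) * (Lagrange.basis (Finset.range (k+1)) (fun i : ℕ => (i:ℝ)) i).eval y :=
      funext fun s => hrep s y
    rw [this]
    have hs := HasDerivAt.fun_sum (u := Finset.range (k+1)) fun (i : ℕ) _ => (hdi (i:ℝ)).mul_const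
      ((Lagrange.basis (Finset.range (k+1)) (fun i : ℕ => (i:ℝ)) i).eval y)
    exact hs.deriv
  have hint : ∀ i c, IntervalIntegrable (fun y => c *
      (Lagrange.basis (Finset.range (k+1)) (fun i : ℕ => (i:ℝ)) i).eval y) volume a b :=
    fun i c => (continuous_const.mul (Polynomial.continuous _)).intervalIntegrable _ _
  have e1 : (fun t => ∫ y in a..b, (p t).eval y) = fun t => ∑ i ∈ Finset.range (k+1),
      (p t).eval (i:ℝ) *
        ∫ y in a..b, (Lagrange.basis (Finset.range (k+1)) (fun i : ℕ => (i:ℝ)) i).eval y := by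
    funext t
    rw [intervalIntegral.integral_congr (fun y _ => hrep t y),
      intervalIntegral.integral_finsetSum (fun i _ => hint i _)]
    simp only [intervalIntegral.integral_const_mul]
  rw [e1, intervalIntegral.integral_congr (fun y _ => hder y),
      intervalIntegral.integral_finsetSum (fun i _ => hint i _)]
  simp only [intervalIntegral.integral_const_mul]
  exact HasDerivAt.fun_sum fun i _ => (hdi (i:ℝ)).mul_const _

lemma mass_conserved (k N : ℕ) (hN : 1 ≤ N) (x : ℕ → ℝ) (T : ℝ) (inflow : ℝ → ℝ)
    (uh : ℕ → ℝ → ℝ[X]) (h : IsDGSol k N x T inflow uh)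
    (hin : ∀ t, inflow t = (uh N t).eval (x N)) (t : ℝ) (ht : t ∈ Set.Icc (0:ℝ) T) :
    ∑ j ∈ Finset.Icc 1 N, ∫ y in (x (j-1))..(x j), (uh j t).eval y =
      ∑ j ∈ Finset.Icc 1 N, ∫ y in (x (j-1))..(x j), (uh j 0).eval y := by
  obtain ⟨h1, h2, h3⟩ := h
  have hd : ∀ t, HasDerivAt (fun t => ∑ j ∈ Finset.Icc 1 N, ∫ y in (x (j-1))..(x j), (uh j t).eval y)
      (∑ j ∈ Finset.Icc 1 N, ∫ y in (x (j-1))..(x j), deriv (fun s => (uh j s).eval y) t) t :=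
    fun t => HasDerivAt.fun_sum fun j hj => poly_integral_deriv k (uh j) (h1 j hj) (h2 j hj) _ _ t
  refine constant_of_has_deriv_right_zero (f := fun t => ∑ j ∈ Finset.Icc 1 N,
      ∫ y in (x (j-1))..(x j), (uh j t).eval y) (a := 0) (b := T)
    (fun s _ => (hd s).continuousAt.continuousWithinAt) (fun s hs => ?_) t ht
  have hz : ∑ j ∈ Finset.Icc 1 N, ∫ y in (x (j-1))..(x j), deriv (fun s => (uh j s).eval y) s = 0 := by
    set e : ℕ → ℝ := fun j => if j = 0 then inflow s else (uh j s).eval (x j) with he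
    have : ∀ j ∈ Finset.Icc 1 N, ∫ y in (x (j-1))..(x j), deriv (fun s => (uh j s).eval y) s =
        -(e j - e (j-1)) := by
      intro j hj
      have h4 := h3 j hj s ⟨hs.1, hs.2.le⟩ 1 (by simp)
      simp at h4
      rw [Finset.mem_Icc] at hj
      have hj0 : j ≠ 0 := by omega
      have e1 : e j = (uh j s).eval (x j) := by simp [he, hj0]
      have e2 : e (j-1) = if j = 1 then inflow s else (uh (j-1) s).eval (x (j-1)) := by
        by_cases hj1 : j = 1
        · simp [he, hj1]
        · have : j - 1 ≠ 0 := by omega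
          simp [he, hj1, this]
      rw [e1, e2]
      linarith
    rw [Finset.sum_congr rfl this, Finset.sum_neg_distrib, telescope_Icc]
    simp [he, hin]
  have := hd s
  rw [hz] at this
  exact this.hasDerivWithinAt

lemma sum_cells (x : ℕ → ℝ) (N : ℕ) (f : ℝ → ℝ) (hf : Continuous f) :
    ∑ j ∈ Finset.Icc 1 N, ∫ y in (x (j-1))..(x j), f y = ∫ y in (x 0)..(x N), f y := by
  have := telescope_Icc (fun j => ∫ y in (x 0)..(x j), f y) N
  simp only [intervalIntegral.integral_same, sub_zero] at this
  rw [← this]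
  refine Finset.sum_congr rfl fun j _ => ?_
  rw [eq_sub_iff_add_eq, add_comm]
  exact intervalIntegral.integral_add_adjacent_intervals (hf.intervalIntegrable _ _)
    (hf.intervalIntegrable _ _)

lemma periodic_mass (u0 : ℝ → ℝ) (hp : ∀ y, u0 (y + 2 * Real.pi) = u0 y) (t : ℝ) :
    ∫ y in (0:ℝ)..(2*Real.pi), u0 (y - t) = ∫ y in (0:ℝ)..(2*Real.pi), u0 (y - 0) := by
  have hper : Function.Periodic u0 (2*Real.pi) := hp
  rw [intervalIntegral.integral_comp_sub_right, intervalIntegral.integral_comp_sub_right]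
  have := hper.intervalIntegral_add_eq (0 - t) (0 - 0)
  convert this using 2 <;> ring

/-- one-cell estimate at time zero -/
lemma cell_est (k : ℕ) (hk : 1 ≤ k) (a b : ℝ) (hab : a < b) (u0 : ℝ → ℝ)
    (hu : ContDiff ℝ (2*k+1) u0) (M B1 B2 : ℝ)
    (hM : ∀ y ∈ Set.Icc a b, |iteratedDeriv (2*k+1) u0 y| ≤ M)
    (hB1 : ∀ x ∈ Set.Icc a b, |legendreCell k a b x| ≤ B1)
    (hB2 : ∀ x ∈ Set.Icc a b,
      |∑ l ∈ Finset.range (k+1), (2*(l:ℝ)+1) * legendreCell l a b x| ≤ B2)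
    (P : ℝ → ℝ[X]) (hP : IsGRProj k a b (fun y => u0 (y - 0)) (P 0))
    (F : ℕ → ℝ[X]) (hF : IsFSeq k a b F) :
    |∫ y in a..b, (u0 (y - 0) - uIl k a b u0 P F k y 0)| ≤
      B1 * (1 + B2) * (b-a)^(2*k+1) * M * (b - a) := by
  have hu' : ContDiff ℝ ((2*k+1 : ℕ)) u0 := by exact_mod_cast hu
  have hmean : ∫ y in a..b, (P 0).eval y = ∫ y in a..b, u0 (y - 0) := by
    simpa using hP.2.1 1 (by simpa using hk)
  have hw : ∫ y in a..b, wSum k a b u0 F k y 0 =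
      ((b-a)/2)^k * Gfun k a b u0 k 0 * ∫ y in a..b, (F k).eval y := by
    unfold wSum wFun
    have hii : ∀ i ∈ Finset.Icc 1 k, IntervalIntegrable
        (fun y => ((b - a) / 2) ^ i * Gfun k a b u0 i 0 * (F i).eval y) volume a b :=
      fun i _ => (continuous_const.mul (Polynomial.continuous _)).intervalIntegrable _ _
    rw [intervalIntegral.integral_finsetSum hii]
    simp only [intervalIntegral.integral_const_mul]
    refine Finset.sum_eq_single k ?_ ?_
    · intro i hi hik
      rw [Finset.mem_Icc] at hi
      rw [F_mean_zero k a b hab F hF i hi.1 (by omega), mul_zero]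
    · intro h; exact absurd (Finset.mem_Icc.2 ⟨hk, le_refl _⟩) h
  have hwc : Continuous fun y => wSum k a b u0 F k y 0 := by
    unfold wSum wFun
    exact continuous_finsetSum _ fun i _ => continuous_const.mul (Polynomial.continuous _)
  have hint : ∫ y in a..b, (u0 (y - 0) - uIl k a b u0 P F k y 0) =
      ∫ y in a..b, wSum k a b u0 F k y 0 := by
    unfold uIl
    have hc := hu.continuous
    have i1 : IntervalIntegrable (fun y => u0 (y - 0)) volume a b :=
      Continuous.intervalIntegrable (by fun_prop) _ _
    have i2 : IntervalIntegrable (fun y => (P 0).eval y - wSum k a b u0 F k y 0) volume a b :=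
      ((P 0).continuous.sub hwc).intervalIntegrable _ _
    rw [intervalIntegral.integral_sub i1 i2,
      intervalIntegral.integral_sub ((P 0).continuous.intervalIntegrable _ _)
      (hwc.intervalIntegrable _ _), hmean]
    ring
  have hG : |Gfun k a b u0 k 0| ≤ (1 + B2) * (M * (b-a)^(k+1)) := by
    unfold Gfun
    rw [radau_iter a b (k+1) (2*k+1) u0 hu' k (by omega)]
    simp only [sub_zero, abs_mul, abs_pow, abs_neg, abs_one, one_pow, one_mul]
    refine radau_bound k a b hab _ ?_ M ?_ B2 hB2
    · rw [iteratedDeriv_eq_iterate]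
      have := ContDiff.iterate_deriv' (k+1) k (f := u0)
        (by rw [show k+1+k = 2*k+1 by omega]; exact hu')
      exact_mod_cast this
    · intro y hy
      have e : iteratedDeriv (k+1) (iteratedDeriv k u0) = iteratedDeriv (2*k+1) u0 := by
        simp only [iteratedDeriv_eq_iterate]
        rw [← Function.iterate_add_apply, show k+1+k = 2*k+1 by omega]
      rw [e]; exact hM y hy
  have hFm := F_mean_bound k hk a b hab F hF B1 hB1
  rw [hint, hw]
  calc |((b-a)/2)^k * Gfun k a b u0 k 0 * ∫ y in a..b, (F k).eval y|
      = |((b-a)/2)^k * ∫ y in a..b, (F k).eval y| * |Gfun k a b u0 k 0| := by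
        rw [← abs_mul]; congr 1; ring
    _ ≤ (B1 * (b-a)^k * (b-a)) * ((1 + B2) * (M * (b-a)^(k+1))) :=
        mul_le_mul hFm hG (abs_nonneg _) ((abs_nonneg _).trans hFm)
    _ = _ := by ring

end PartThree

/-- superconvergence of the domain average, periodic boundary condition:
`|(1/2π) ∫_0^{2π} (u - u_h)(x,t) dx| ≤ C h^{2k+1} M_{2k+1}`. -/
theorem stmt14 (k : ℕ) (hk : 1 ≤ k) (c : ℝ) (hc : 1 ≤ c) :
    ∃ C : ℝ, 0 < C ∧
      ∀ (N : ℕ) (x : ℕ → ℝ) (h T : ℝ), 1 ≤ N → x 0 = 0 → x N = 2 * Real.pi →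
        (∀ j < N, x j < x (j+1)) →
        (∀ j ∈ Finset.Icc 1 N, x j - x (j-1) ≤ h) →
        (∀ j ∈ Finset.Icc 1 N, h ≤ c * (x j - x (j-1))) →
        0 < T →
        ∀ u0 : ℝ → ℝ, ContDiff ℝ (2*k+1) u0 →
        (∀ y : ℝ, u0 (y + 2 * Real.pi) = u0 y) →
        ∀ M : ℝ,
          (∀ i ≤ 2*k+1, ∀ y ∈ Set.Icc (-T) (2 * Real.pi), |iteratedDeriv i u0 y| ≤ M) →
        ∀ P : ℕ → ℝ → Polynomial ℝ,
          (∀ j ∈ Finset.Icc 1 N, ∀ t : ℝ,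
            IsGRProj k (x (j-1)) (x j) (fun y => u0 (y - t)) (P j t)) →
        ∀ F : ℕ → ℕ → Polynomial ℝ,
          (∀ j ∈ Finset.Icc 1 N, IsFSeq k (x (j-1)) (x j) (F j)) →
        ∀ (inflow : ℝ → ℝ) (uh : ℕ → ℝ → Polynomial ℝ),
          IsDGSol k N x T inflow uh →
          (∀ t, inflow t = (uh N t).eval (x N)) →
          (∀ j ∈ Finset.Icc 1 N, ∀ y ∈ Set.Icc (x (j-1)) (x j),
            (uh j 0).eval y = uIl k (x (j-1)) (x j) u0 (P j) (F j) k y 0) →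
        ∀ t ∈ Set.Icc (0:ℝ) T,
          |(1/(2 * Real.pi)) * ∑ j ∈ Finset.Icc 1 N,
              ∫ y in (x (j-1))..(x j), (u0 (y - t) - (uh j t).eval y)|
            ≤ C * h^(2*k+1) * M := by
  obtain ⟨B1, hB11, hB1⟩ := LP_bound k
  obtain ⟨B2, hB21, hB2⟩ := KP_bound k
  refine ⟨B1 * (1 + B2), by positivity, ?_⟩
  intro N x h T hN hx0 hxN hmono hh _ hT u0 hu hper M hM P hP F hF inflow uh hDG hin hinit t ht
  have hlt : ∀ j ∈ Finset.Icc 1 N, x (j-1) < x j := by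
    intro j hj
    rw [Finset.mem_Icc] at hj
    have := hmono (j-1) (by omega)
    rwa [show j - 1 + 1 = j by omega] at this
  have hpos : ∀ i ≤ N, 0 ≤ x i := by
    intro i
    induction i with
    | zero => intro _; exact hx0.ge
    | succ i ih => intro hi; linarith [ih (by omega), hmono i (by omega)]
  have hle : ∀ i ≤ N, x (N - i) ≤ 2 * Real.pi := by
    intro i
    induction i with
    | zero => intro _; exact hxN.le
    | succ i ih =>
      intro hi
      have h1 := ih (by omega)
      have h2 := hmono (N - (i+1)) (by omega)
      rw [show N - (i+1) + 1 = N - i by omega] at h2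
      linarith
  have hc := hu.continuous
  have hM0 : 0 ≤ M := (abs_nonneg _).trans
    (hM 0 (by omega) 0 ⟨by linarith, by positivity⟩)
  have hsplit : ∀ s, ∑ j ∈ Finset.Icc 1 N,
      ∫ y in (x (j-1))..(x j), (u0 (y - s) - (uh j s).eval y) =
      (∫ y in (0:ℝ)..(2*Real.pi), u0 (y - s)) -
        ∑ j ∈ Finset.Icc 1 N, ∫ y in (x (j-1))..(x j), (uh j s).eval y := by
    intro s
    rw [← hx0, ← hxN, ← sum_cells x N (fun y => u0 (y - s)) (by fun_prop),
      ← Finset.sum_sub_distrib]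
    refine Finset.sum_congr rfl fun j _ => ?_
    exact intervalIntegral.integral_sub (Continuous.intervalIntegrable (by fun_prop) _ _)
      ((uh j s).continuous.intervalIntegrable _ _)
  rw [hsplit t, periodic_mass u0 hper t, mass_conserved k N hN x T inflow uh hDG hin t ht,
    ← hsplit 0]
  have hcell : ∀ j ∈ Finset.Icc 1 N,
      |∫ y in (x (j-1))..(x j), (u0 (y - 0) - (uh j 0).eval y)| ≤
        B1 * (1 + B2) * h^(2*k+1) * M * (x j - x (j-1)) := by
    intro j hj
    have hl := hlt j hj
    have hj' := Finset.mem_Icc.1 hj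
    have e : ∫ y in (x (j-1))..(x j), (u0 (y - 0) - (uh j 0).eval y) =
        ∫ y in (x (j-1))..(x j), (u0 (y - 0) - uIl k (x (j-1)) (x j) u0 (P j) (F j) k y 0) := by
      refine intervalIntegral.integral_congr fun y hy => ?_
      rw [Set.uIcc_of_le hl.le] at hy
      simp only [hinit j hj y hy]
    rw [e]
    refine (cell_est k hk _ _ hl u0 hu M B1 B2 ?_ (hB1 _ _ hl) (hB2 _ _ hl) (P j)
      (hP j hj 0) (F j) (hF j hj)).trans ?_
    · intro y hy
      refine hM _ (le_refl _) y ⟨?_, ?_⟩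
      · linarith [hpos (j-1) (by omega), hy.1]
      · have := hle (N - j) (by omega)
        rw [show N - (N - j) = j by omega] at this
        linarith [hy.2]
    · have hd : 0 < x j - x (j-1) := by linarith
      have hp : (x j - x (j-1))^(2*k+1) ≤ h^(2*k+1) :=
        pow_le_pow_left₀ hd.le (hh j hj) _
      gcongr
  have hsum : |∑ j ∈ Finset.Icc 1 N, ∫ y in (x (j-1))..(x j), (u0 (y - 0) - (uh j 0).eval y)| ≤
      B1 * (1 + B2) * h^(2*k+1) * M * (2 * Real.pi) := by
    refine (Finset.abs_sum_le_sum_abs _ _).trans ((Finset.sum_le_sum hcell).trans ?_)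
    rw [← Finset.mul_sum, telescope_Icc, hx0, hxN, sub_zero]
  have hpi := Real.pi_pos
  rw [abs_mul, abs_of_pos (by positivity : 0 < 1/(2*Real.pi))]
  calc _ ≤ 1/(2*Real.pi) * (B1 * (1 + B2) * h^(2*k+1) * M * (2 * Real.pi)) :=
        mul_le_mul_of_nonneg_left hsum (by positivity)
    _ = _ := by field_simp
end

section
/- There is a constant C depending only on k such that for every cell τ_j, every function w of class C^{k+2} on the closure of τ_j, and every interior left Radau point r of τ_j, i.e. every r ∈ (x_{j-1/2}, x_{j+1/2}) with L_{j,k+1}(r) + L_{j,k}(r) = 0, the derivative error of the Gauss–Radau projection satisfies |(w − P_h^- w)'(r)| ≤ C h_j^{k+1} max_{0≤i≤k+2} sup_{x ∈ τ_j} |w^{(i)}(x)|. -/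
open MeasureTheory intervalIntegral

section Aux
open Polynomial

lemma aux_iteratedDeriv (p : ℝ[X]) (n : ℕ) :
    iteratedDeriv n (fun t => p.eval t) = fun t => (derivative^[n] p).eval t := by
  induction n with
  | zero => simp
  | succ n ih =>
    rw [iteratedDeriv_succ, ih, Function.iterate_succ_apply']
    funext t
    simp

lemma aux_legendre (m : ℕ) (s : ℝ) :
    legendreP m s = (1 / ((2:ℝ) ^ m * (Nat.factorial m : ℝ))) *
      (derivative^[m] ((X ^ 2 - 1 : ℝ[X]) ^ m)).eval s := by
  unfold legendreP
  have h : (fun t : ℝ => (t ^ 2 - 1) ^ m) = fun t => ((X ^ 2 - 1 : ℝ[X]) ^ m).eval t := by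
    funext t; simp
  rw [h, aux_iteratedDeriv]

/-- unnormalised right Radau polynomial -/
noncomputable def auxRho (k : ℕ) : ℝ[X] := derivative^[k] ((X - 1) * (X ^ 2 - 1) ^ k)

lemma aux_D_linear (p : ℝ[X]) (c : ℝ) (n : ℕ) :
    derivative^[n + 1] (p * (X + C c)) =
      (derivative^[n + 1] p) * (X + C c) + ((n : ℝ[X]) + 1) * derivative^[n] p := by
  induction n with
  | zero => simp [derivative_mul]
  | succ n ih =>
    rw [Function.iterate_succ_apply', ih]
    simp only [derivative_add, derivative_mul, ← Function.iterate_succ_apply' derivative]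
    simp
    ring

lemma aux_D_add (p q : ℝ[X]) (n : ℕ) :
    derivative^[n] (p + q) = derivative^[n] p + derivative^[n] q :=
  iterate_map_add derivative n p q

lemma aux_D_pow (k : ℕ) : derivative^[k + 1] ((X ^ 2 - 1 : ℝ[X]) ^ (k + 1)) =
    derivative^[k] (C (2 * ((k : ℝ) + 1)) * (X * (X ^ 2 - 1) ^ k)) := by
  rw [Function.iterate_succ_apply]
  congr 1
  rw [derivative_pow, show (C (2 * ((k : ℝ) + 1)) : ℝ[X]) = 2 * ((k : ℝ[X]) + 1) by
    rw [C_mul, C_add, C_1, show (C (2:ℝ) : ℝ[X]) = 2 by rfl]; simp]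
  simp
  ring

lemma aux_rho_identity (k : ℕ) :
    derivative (auxRho k) * (X + 1) =
      ((k : ℝ[X]) + 1) * derivative^[k] ((X + 1) * (X ^ 2 - 1) ^ k) := by
  have h1 := aux_D_linear ((X - 1) * (X ^ 2 - 1) ^ k) 1 k
  have h2 : ((X - 1) * (X ^ 2 - 1) ^ k) * (X + C 1) = (X ^ 2 - 1 : ℝ[X]) ^ (k + 1) := by
    simp; ring
  rw [h2, aux_D_pow, iterate_derivative_C_mul] at h1
  have h3 : (X * (X ^ 2 - 1) ^ k : ℝ[X]) =
    C (1/2) * ((X + 1) * (X ^ 2 - 1) ^ k) + C (1/2) * ((X - 1) * (X ^ 2 - 1) ^ k) := by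
    have : (C (1/2) : ℝ[X]) * 2 = 1 := by
      rw [show (2 : ℝ[X]) = C 2 by rfl, ← C_mul]; norm_num
    linear_combination (-(X * (X ^ 2 - 1) ^ k)) * this
  rw [h3, aux_D_add, iterate_derivative_C_mul, iterate_derivative_C_mul] at h1
  have h4 : (C (2 * ((k : ℝ) + 1)) : ℝ[X]) * C (1/2) = (k : ℝ[X]) + 1 := by
    rw [← C_mul]; ring_nf; simp
  unfold auxRho
  rw [← Function.iterate_succ_apply' derivative]
  simp only [map_one] at h1
  linear_combination (-1) * h1 + (derivative^[k] ((X + 1) * (X ^ 2 - 1) ^ k) + derivative^[k] ((X - 1) * (X ^ 2 - 1) ^ k)) * h4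

lemma aux_legendre_sum (k : ℕ) (s : ℝ) :
    legendreP (k + 1) s + legendreP k s = (1 / ((2:ℝ) ^ k * (Nat.factorial k : ℝ))) *
      (derivative^[k] ((X + 1 : ℝ[X]) * (X ^ 2 - 1) ^ k)).eval s := by
  rw [aux_legendre, aux_legendre, aux_D_pow, iterate_derivative_C_mul, add_mul,
    aux_D_add, one_mul, eval_add, eval_mul, eval_C, Nat.factorial_succ]
  have : (Nat.factorial k : ℝ) ≠ 0 := by positivity
  have : (k : ℝ) + 1 ≠ 0 := by positivity
  push_cast
  field_simp
  ring

lemma aux_rho_root (k : ℕ) (s : ℝ) (hs : -1 < s) (h : legendreP (k + 1) s + legendreP k s = 0) :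
    (derivative (auxRho k)).eval s = 0 := by
  rw [aux_legendre_sum] at h
  have h2 := congrArg (eval s) (aux_rho_identity k)
  have h3 : (1 / ((2:ℝ) ^ k * (Nat.factorial k : ℝ))) ≠ 0 := by positivity
  rw [eval_mul, eval_mul, (mul_eq_zero.mp h).resolve_left h3, mul_zero] at h2
  refine (mul_eq_zero.mp h2).resolve_right ?_
  simp; linarith

lemma aux_orth (m : ℕ) : ∀ Q : ℝ[X],
    (∀ i < m, (derivative^[i] Q).eval 1 = 0 ∧ (derivative^[i] Q).eval (-1) = 0) →
    ∀ v : ℝ[X], v.degree < m →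
      (∫ x in (-1:ℝ)..1, (derivative^[m] Q).eval x * v.eval x) = 0 := by
  induction m with
  | zero =>
    intro Q _ v hv
    have : v = 0 := by simpa using hv
    simp [this]
  | succ m ih =>
    intro Q hQ v hv
    have hv' : (derivative v).degree < m := by
      rw [degree_lt_iff_coeff_zero] at hv ⊢
      intro n hn
      rw [coeff_derivative, hv (n + 1) (by omega), zero_mul]
    have h := ih Q (fun i hi => hQ i (by omega)) _ hv'
    have hp := intervalIntegral.integral_deriv_mul_eq_sub_of_hasDerivAt (a := (-1:ℝ)) (b := 1)
      (u := fun x => (derivative^[m] Q).eval x) (v := fun x => v.eval x)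
      (u' := fun x => (derivative^[m+1] Q).eval x) (v' := fun x => (derivative v).eval x)
      (Polynomial.continuous _).continuousOn (Polynomial.continuous _).continuousOn
      (fun x _ => by
        rw [Function.iterate_succ_apply']
        exact Polynomial.hasDerivAt _ x)
      (fun x _ => Polynomial.hasDerivAt _ x)
      ((Polynomial.continuous _).intervalIntegrable _ _)
      ((Polynomial.continuous _).intervalIntegrable _ _)
    rw [intervalIntegral.integral_add, h, (hQ m (by omega)).1, (hQ m (by omega)).2] at hp
    · simpa using hp
    · apply Continuous.intervalIntegrable; fun_prop
    · apply Continuous.intervalIntegrable; fun_prop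

lemma aux_rho_dvd (k : ℕ) : (X - C (1:ℝ)) ^ (k + 1) ∣ (X - 1) * (X ^ 2 - 1 : ℝ[X]) ^ k := by
  refine ⟨(X + 1) ^ k, ?_⟩
  rw [show (X ^ 2 - 1 : ℝ[X]) = (X - 1) * (X + 1) by ring, mul_pow, C_1]
  ring

lemma aux_rho_dvd' (k : ℕ) : (X - C (-1:ℝ)) ^ k ∣ (X - 1) * (X ^ 2 - 1 : ℝ[X]) ^ k := by
  refine ⟨(X - 1) ^ (k + 1), ?_⟩
  rw [show (X ^ 2 - 1 : ℝ[X]) = (X - 1) * (X + 1) by ring, mul_pow, C_neg, C_1]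
  ring

lemma aux_eval_zero (Q : ℝ[X]) (c : ℝ) (n i : ℕ) (h : (X - C c) ^ n ∣ Q) (hi : i < n) :
    (derivative^[i] Q).eval c = 0 := by
  have := pow_sub_dvd_iterate_derivative_of_pow_dvd i h
  have h2 : (X - C c) ∣ derivative^[i] Q := (dvd_pow_self _ (by omega)).trans this
  exact dvd_iff_isRoot.mp h2

lemma aux_rho_one (k : ℕ) : (auxRho k).eval 1 = 0 :=
  aux_eval_zero _ _ _ _ (aux_rho_dvd k) (by omega)

lemma aux_rho_orth (k : ℕ) (v : ℝ[X]) (hv : v.degree < k) :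
    (∫ x in (-1:ℝ)..1, (auxRho k).eval x * v.eval x) = 0 :=
  aux_orth k _ (fun i hi => ⟨aux_eval_zero _ _ _ _ (aux_rho_dvd k) (by omega),
    aux_eval_zero _ _ _ _ (aux_rho_dvd' k) hi⟩) v hv

lemma aux_rho_natDegree0 (k : ℕ) : ((X - 1) * (X ^ 2 - 1 : ℝ[X]) ^ k).Monic ∧
    ((X - 1) * (X ^ 2 - 1 : ℝ[X]) ^ k).natDegree = 2 * k + 1 := by
  have h1 : (X - 1 : ℝ[X]).Monic := by simpa using monic_X_sub_C (1:ℝ)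
  have h2 : (X ^ 2 - 1 : ℝ[X]).Monic := by simpa using monic_X_pow_sub_C (1:ℝ) (n := 2) (by norm_num)
  refine ⟨h1.mul (h2.pow k), ?_⟩
  rw [h1.natDegree_mul (h2.pow k), h2.natDegree_pow,
    show (X - 1 : ℝ[X]) = X - C 1 by simp, natDegree_X_sub_C,
    show (X ^ 2 - 1 : ℝ[X]) = X ^ 2 - C 1 by simp, natDegree_X_pow_sub_C]
  ring

lemma aux_rho_natDegree (k : ℕ) : (auxRho k).natDegree ≤ k + 1 := by
  refine (natDegree_iterate_derivative _ _).trans ?_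
  rw [(aux_rho_natDegree0 k).2]; omega

lemma aux_rho_coeff (k : ℕ) : (auxRho k).coeff (k + 1) ≠ 0 := by
  unfold auxRho
  rw [coeff_iterate_derivative]
  have h := (aux_rho_natDegree0 k).1.coeff_natDegree
  rw [(aux_rho_natDegree0 k).2] at h
  rw [show k + 1 + k = 2 * k + 1 by ring, h]
  simp [Nat.descFactorial_eq_zero_iff_lt]
  omega

lemma aux_inj (k : ℕ) (S : ℝ[X]) (hS : S.natDegree ≤ k) (h1 : S.eval 1 = 0)
    (h : ∀ i < k, (∫ x in (-1:ℝ)..1, S.eval x * x ^ i) = 0) : S = 0 := by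
  obtain ⟨g, rfl⟩ := dvd_iff_isRoot.mpr h1
  by_contra hne
  have hg : g ≠ 0 := right_ne_zero_of_mul hne
  have hd : g.natDegree < k := by
    rw [natDegree_mul (X_sub_C_ne_zero _) hg, natDegree_X_sub_C] at hS
    omega
  have hz : (∫ x in (-1:ℝ)..1, ((X - C 1) * g).eval x * g.eval x) = 0 := by
    have : ∀ x : ℝ, ((X - C 1) * g).eval x * g.eval x =
        ∑ i ∈ Finset.range k, g.coeff i * (((X - C 1) * g).eval x * x ^ i) := by
      intro x
      rw [show g.eval x = _ from eval_eq_sum_range' hd x, Finset.mul_sum]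
      exact Finset.sum_congr rfl fun i _ => by ring
    simp_rw [this]
    rw [intervalIntegral.integral_finsetSum]
    · refine Finset.sum_eq_zero fun i hi => ?_
      rw [intervalIntegral.integral_const_mul, h i (Finset.mem_range.mp hi), mul_zero]
    · intro i _
      apply Continuous.intervalIntegrable
      fun_prop
  obtain ⟨c, hc, hgc⟩ : ∃ c ∈ Set.Ioo (-1:ℝ) 1, g.eval c ≠ 0 := by
    by_contra! hcon
    exact hg (eq_zero_of_infinite_isRoot g
      ((Set.Ioo_infinite (by norm_num : (-1:ℝ) < 1)).mono fun x hx => hcon x hx))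
  have hpos : 0 < ∫ x in (-1:ℝ)..1, (1 - x) * (g.eval x) ^ 2 := by
    apply intervalIntegral.integral_pos (by norm_num)
    · fun_prop
    · intro x hx
      have : 0 ≤ 1 - x := by linarith [hx.2]
      positivity
    · refine ⟨c, ⟨hc.1.le, hc.2.le⟩, ?_⟩
      have : 0 < 1 - c := by linarith [hc.2]
      positivity
  have : (∫ x in (-1:ℝ)..1, (1 - x) * (g.eval x) ^ 2) =
      - ∫ x in (-1:ℝ)..1, ((X - C 1) * g).eval x * g.eval x := by
    rw [← intervalIntegral.integral_neg]
    congr 1; funext x; simp; ring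
  rw [this, hz] at hpos
  simp at hpos

/-- moments map -/
noncomputable def auxPhi (k : ℕ) : degreeLT ℝ (k + 1) →ₗ[ℝ] (Fin (k + 1) → ℝ) where
  toFun S i := if (i : ℕ) < k then ∫ x in (-1:ℝ)..1, (S : ℝ[X]).eval x * x ^ (i : ℕ)
    else (S : ℝ[X]).eval 1
  map_add' S T := by
    funext i
    simp only [Pi.add_apply]
    split_ifs
    · rw [← intervalIntegral.integral_add]
      · congr 1; funext x; simp; ring
      · apply Continuous.intervalIntegrable; fun_prop
      · apply Continuous.intervalIntegrable; fun_prop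
    · simp
  map_smul' c S := by
    funext i
    simp only [Pi.smul_apply, smul_eq_mul, RingHom.id_apply]
    split_ifs
    · rw [← intervalIntegral.integral_const_mul]
      congr 1; funext x; simp; ring
    · simp

lemma aux_stab (k : ℕ) : ∃ C : ℝ, 0 < C ∧ ∀ S : ℝ[X], S.natDegree ≤ k → ∀ B : ℝ,
    |S.eval 1| ≤ B → (∀ i < k, |∫ x in (-1:ℝ)..1, S.eval x * x ^ i| ≤ B) →
    ∀ r ∈ Set.Icc (-1:ℝ) 1, |(derivative S).eval r| ≤ C * B := by
  have hinj : LinearMap.ker (auxPhi k) = ⊥ := by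
    rw [LinearMap.ker_eq_bot']
    intro S hS
    have hS' : ∀ i, auxPhi k S i = 0 := fun i => congrFun hS i
    have hd : (S : ℝ[X]).natDegree ≤ k := by
      have := mem_degreeLT.mp S.2
      exact natDegree_le_of_degree_le (Order.lt_succ_iff.mp (by exact_mod_cast this))
    apply Subtype.ext
    refine aux_inj k S hd ?_ ?_
    · simpa [auxPhi] using hS' (Fin.last k)
    · intro i hi
      simpa [auxPhi, hi] using hS' ⟨i, by omega⟩
  obtain ⟨g, hg⟩ := (auxPhi k).exists_leftInverse_of_injective hinj
  have hbd : ∀ i : Fin (k + 1), ∃ c : ℝ, ∀ r ∈ Set.Icc (-1:ℝ) 1,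
      |(derivative (g (Pi.single i 1) : ℝ[X])).eval r| ≤ c := by
    intro i
    obtain ⟨c, hc⟩ := isCompact_Icc.exists_bound_of_continuousOn
      (s := Set.Icc (-1:ℝ) 1) (Polynomial.continuous (derivative (g (Pi.single i 1) : ℝ[X]))).continuousOn
    exact ⟨c, hc⟩
  choose c hc using hbd
  refine ⟨∑ i, |c i| + 1, by positivity, ?_⟩
  intro S hS B h1 hB r hr
  have hmem : S ∈ degreeLT ℝ (k + 1) := by
    rw [mem_degreeLT]
    exact (degree_le_of_natDegree_le hS).trans_lt (by exact_mod_cast Nat.lt_succ_self k)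
  have hB0 : 0 ≤ B := (abs_nonneg _).trans h1
  have hrep : (⟨S, hmem⟩ : degreeLT ℝ (k+1)) =
      ∑ i, auxPhi k ⟨S, hmem⟩ i • g (Pi.single i 1) := by
    have h := LinearMap.congr_fun hg ⟨S, hmem⟩
    rw [LinearMap.comp_apply, LinearMap.id_apply, LinearMap.pi_apply_eq_sum_univ] at h
    rw [← h]
    refine Finset.sum_congr rfl fun i _ => ?_
    rw [h]
    congr 2
    funext j
    simp [Pi.single_apply, eq_comm]
  have hm : ∀ i, |auxPhi k ⟨S, hmem⟩ i| ≤ B := by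
    intro i
    simp only [auxPhi, LinearMap.coe_mk, AddHom.coe_mk]
    split_ifs with hi
    · exact hB i hi
    · exact h1
  have hrep2 : (derivative S).eval r =
      ∑ i, auxPhi k ⟨S, hmem⟩ i * (derivative (g (Pi.single i 1) : ℝ[X])).eval r := by
    have := congrArg (fun p : degreeLT ℝ (k+1) => (derivative (p : ℝ[X])).eval r) hrep
    simpa [eval_finsetSum, derivative_sum] using this
  rw [hrep2]
  calc _ ≤ ∑ i, |auxPhi k ⟨S, hmem⟩ i * (derivative (g (Pi.single i 1) : ℝ[X])).eval r| :=
        Finset.abs_sum_le_sum_abs _ _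
    _ ≤ ∑ i, |c i| * B := by
        refine Finset.sum_le_sum fun i _ => ?_
        rw [abs_mul, mul_comm]
        exact mul_le_mul ((hc i r hr).trans (le_abs_self _)) (hm i) (abs_nonneg _) (abs_nonneg _)
    _ = (∑ i, |c i|) * B := by rw [Finset.sum_mul]
    _ ≤ _ := by nlinarith

lemma aux_core (k : ℕ) : ∃ C : ℝ, 0 < C ∧ ∀ p : ℝ[X], p.natDegree ≤ k + 1 → ∀ B : ℝ,
    |p.eval 1| ≤ B → (∀ i < k, |∫ x in (-1:ℝ)..1, p.eval x * x ^ i| ≤ B) →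
    ∀ r ∈ Set.Ioo (-1:ℝ) 1, legendreP (k + 1) r + legendreP k r = 0 →
    |(derivative p).eval r| ≤ C * B := by
  obtain ⟨K, hK, hstab⟩ := aux_stab k
  refine ⟨K, hK, ?_⟩
  intro p hp B h1 hB r hr hroot
  set c := p.coeff (k + 1) / (auxRho k).coeff (k + 1) with hcdef
  have hdeg : (p - C c * auxRho k).natDegree ≤ k := by
    rw [natDegree_le_iff_coeff_eq_zero]
    intro n hn
    rw [coeff_sub, coeff_C_mul]
    rcases eq_or_lt_of_le (Nat.succ_le_of_lt hn) with h | h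
    · rw [← h, Nat.succ_eq_add_one, hcdef, div_mul_cancel₀ _ (aux_rho_coeff k), sub_self]
    · rw [coeff_eq_zero_of_natDegree_lt (hp.trans_lt h),
        coeff_eq_zero_of_natDegree_lt ((aux_rho_natDegree k).trans_lt h)]
      simp
  have := hstab (p - C c * auxRho k) hdeg B (by simpa [aux_rho_one] using h1) (by
    intro i hi
    have h0 := aux_rho_orth k (X ^ i) (by rw [degree_X_pow]; exact_mod_cast hi)
    have : (∫ x in (-1:ℝ)..1, (p - C c * auxRho k).eval x * x ^ i) =
        ∫ x in (-1:ℝ)..1, p.eval x * x ^ i := by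
      have e : ∀ x : ℝ, (p - C c * auxRho k).eval x * x ^ i =
          p.eval x * x ^ i - c * ((auxRho k).eval x * (X ^ i : ℝ[X]).eval x) := by
        intro x; simp; ring
      simp_rw [e]
      rw [intervalIntegral.integral_sub, intervalIntegral.integral_const_mul, h0]
      · simp
      · apply Continuous.intervalIntegrable; fun_prop
      · apply Continuous.intervalIntegrable; fun_prop
    rw [this]
    exact hB i hi) r ⟨hr.1.le, hr.2.le⟩
  simpa [derivative_mul, aux_rho_root k r hr.1 hroot] using this

end Aux

lemma aux_taylor (k : ℕ) (a b : ℝ) (hab : a < b) (w : ℝ → ℝ)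
    (hw : ContDiffOn ℝ (k+2) w (Set.Icc a b)) (M : ℝ)
    (hM : ∀ i ≤ k+2, ∀ y ∈ Set.Icc a b, |iteratedDerivWithin i w (Set.Icc a b) y| ≤ M) :
    ∃ T : Polynomial ℝ, T.natDegree ≤ k + 1 ∧
      (∀ x ∈ Set.Icc a b, |w x - T.eval x| ≤ M * (b - a) ^ (k + 2)) ∧
      (∀ x ∈ Set.Icc a b, |derivWithin w (Set.Icc a b) x - T.derivative.eval x|
        ≤ M * (b - a) ^ (k + 1)) := by
  have hM0 : 0 ≤ M := (abs_nonneg _).trans (hM 0 (by omega) a ⟨le_rfl, hab.le⟩)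
  set T : Polynomial ℝ := ∑ i ∈ Finset.range (k + 2),
    Polynomial.C ((Nat.factorial i : ℝ)⁻¹ * iteratedDerivWithin i w (Set.Icc a b) a) *
      (Polynomial.X - Polynomial.C a) ^ i with hT
  have hTe : (fun x => T.eval x) = taylorWithinEval w (k + 1) (Set.Icc a b) a := by
    funext x
    rw [taylor_within_apply, hT, Polynomial.eval_finsetSum]
    refine Finset.sum_congr rfl fun i _ => ?_
    simp; ring
  have hTd : ∀ x, T.derivative.eval x =
      taylorWithinEval (derivWithin w (Set.Icc a b)) k (Set.Icc a b) a x := by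
    intro x
    have h1 := T.hasDerivAt x
    rw [hTe] at h1
    exact h1.unique (hasDerivAt_taylorWithinEval_succ w k)
  have key : ∀ (n : ℕ) (x : ℝ), x ∈ Set.Icc a b →
      M * (x - a) ^ (n + 1) / (Nat.factorial n : ℝ) ≤ M * (b - a) ^ (n + 1) := by
    intro n x hx
    have h1 : (1:ℝ) ≤ (Nat.factorial n : ℝ) := by exact_mod_cast Nat.factorial_pos n
    have h2 : (x - a) ^ (n + 1) ≤ (b - a) ^ (n + 1) :=
      pow_le_pow_left₀ (by linarith [hx.1]) (by linarith [hx.2]) _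
    have h3 : 0 ≤ (x - a) ^ (n + 1) := pow_nonneg (by linarith [hx.1]) _
    exact (div_le_self (by positivity) h1).trans (by gcongr)
  refine ⟨T, ?_, ?_, ?_⟩
  · refine Polynomial.natDegree_sum_le_of_forall_le _ _ fun i hi => ?_
    refine (Polynomial.natDegree_C_mul_le _ _).trans ?_
    rw [Polynomial.natDegree_pow, Polynomial.natDegree_X_sub_C]
    have := Finset.mem_range.mp hi
    omega
  · intro x hx
    rw [congrFun hTe x]
    refine le_trans ?_ (key (k + 1) x hx)
    refine taylor_mean_remainder_bound hab.le (hw.of_le ?_) hx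
      (fun y hy => hM (k + 2) le_rfl y hy)
    norm_cast
  · intro x hx
    rw [hTd]
    refine le_trans ?_ (key k x hx)
    refine taylor_mean_remainder_bound hab.le
      (hw.derivWithin (uniqueDiffOn_Icc hab) (m := (k:WithTop ℕ∞) + 1) ?_) hx ?_
    · norm_cast
    · intro y hy
      rw [← iteratedDerivWithin_succ']
      exact hM (k + 2) le_rfl y hy

/-- the derivative of the Gauss–Radau projection error is superconvergent
of order `k+1` at the interior left Radau points. -/
theorem stmt16 (k : ℕ) (hk : 1 ≤ k) :
    ∃ C : ℝ, 0 < C ∧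
      ∀ (a b : ℝ), a < b →
      ∀ w : ℝ → ℝ, ContDiffOn ℝ (k+2) w (Set.Icc a b) →
      ∀ P : Polynomial ℝ, IsGRProj k a b w P →
      ∀ r ∈ Set.Ioo a b, legendreCell (k+1) a b r + legendreCell k a b r = 0 →
      ∀ M : ℝ,
        (∀ i ≤ k+2, ∀ y ∈ Set.Icc a b, |iteratedDerivWithin i w (Set.Icc a b) y| ≤ M) →
        |derivWithin w (Set.Icc a b) r - P.derivative.eval r|
          ≤ C * (b-a)^(k+1) * M := by
  obtain ⟨K, hK, hcore⟩ := aux_core k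
  refine ⟨1 + 4 * K, by positivity, ?_⟩
  intro a b hab w hw P hP r hr hroot M hM
  obtain ⟨hPd, hPo, hPb⟩ := hP
  obtain ⟨T, hTdeg, hT0, hT1⟩ := aux_taylor k a b hab w hw M hM
  have hM0 : 0 ≤ M := (abs_nonneg _).trans (hM 0 (by omega) a ⟨le_rfl, hab.le⟩)
  have hh : 0 < b - a := by linarith
  have hh0 : b - a ≠ 0 := hh.ne'
  set ℓ : Polynomial ℝ := Polynomial.C ((b - a) / 2) * Polynomial.X + Polynomial.C ((a + b) / 2)
    with hℓ
  have hℓe : ∀ s, ℓ.eval s = (b - a) / 2 * s + (a + b) / 2 := by intro s; simp [hℓ]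
  set p : Polynomial ℝ := (P - T).comp ℓ with hp
  have hpd : p.natDegree ≤ k + 1 := by
    rw [hp, Polynomial.natDegree_comp]
    have h1 : (P - T).natDegree ≤ k + 1 :=
      (Polynomial.natDegree_sub_le _ _).trans (max_le (by omega) hTdeg)
    have h2 : ℓ.natDegree ≤ 1 := Polynomial.natDegree_linear_le
    calc _ ≤ (k + 1) * 1 := Nat.mul_le_mul h1 h2
      _ = _ := by ring
  set B := 2 * (M * (b - a) ^ (k + 2)) with hB
  have hB0 : 0 ≤ M * (b - a) ^ (k + 2) := by positivity
  have hp1 : |p.eval 1| ≤ B := by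
    rw [hp, Polynomial.eval_comp, hℓe, show (b - a) / 2 * 1 + (a + b) / 2 = b by ring,
      Polynomial.eval_sub, hPb]
    exact (hT0 b ⟨hab.le, le_rfl⟩).trans (by linarith)
  have hwc : ContinuousOn w (Set.uIcc a b) := by
    rw [Set.uIcc_of_le hab.le]; exact hw.continuousOn
  have hpm : ∀ i < k, |∫ x in (-1:ℝ)..1, p.eval x * x ^ i| ≤ B := by
    intro i hi
    set v : Polynomial ℝ :=
      (Polynomial.C (2 / (b - a)) * Polynomial.X + Polynomial.C (-(a + b) / (b - a))) ^ i with hv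
    have hve : ∀ x, v.eval x = (2 / (b - a) * x + -(a + b) / (b - a)) ^ i := by
      intro x; simp [hv]
    have hvd : v.natDegree + 1 ≤ k := by
      have h1 : v.natDegree ≤ i * 1 :=
        Polynomial.natDegree_pow_le.trans (Nat.mul_le_mul le_rfl Polynomial.natDegree_linear_le)
      omega
    have e1 : (∫ x in (-1:ℝ)..1, p.eval x * x ^ i) =
        ∫ x in (-1:ℝ)..1, (fun y => (P - T).eval y * v.eval y)
          ((b - a) / 2 * x + (a + b) / 2) := by
      congr 1; funext x
      simp only [hp, Polynomial.eval_comp, hℓe, hve]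
      congr 2
      field_simp
      ring
    rw [e1, intervalIntegral.integral_comp_mul_add (fun y => (P - T).eval y * v.eval y) (by positivity : (b - a) / 2 ≠ 0),
      show (b - a) / 2 * (-1) + (a + b) / 2 = a by ring,
      show (b - a) / 2 * 1 + (a + b) / 2 = b by ring]
    have e2 : (∫ x in a..b, (P - T).eval x * v.eval x) =
        ∫ x in a..b, (w x - T.eval x) * v.eval x := by
      have i1 : IntervalIntegrable (fun x => w x * v.eval x) volume a b :=
        (hwc.mul v.continuous.continuousOn).intervalIntegrable
      have i2 : IntervalIntegrable (fun x => T.eval x * v.eval x) volume a b :=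
        (T.continuous.mul v.continuous).intervalIntegrable _ _
      have i3 : IntervalIntegrable (fun x => P.eval x * v.eval x) volume a b :=
        (P.continuous.mul v.continuous).intervalIntegrable _ _
      simp_rw [Polynomial.eval_sub, sub_mul]
      rw [intervalIntegral.integral_sub i3 i2, intervalIntegral.integral_sub i1 i2, hPo v hvd]
    rw [e2, smul_eq_mul, abs_mul]
    have hb : ‖∫ x in a..b, (w x - T.eval x) * v.eval x‖ ≤
        (M * (b - a) ^ (k + 2)) * |b - a| := by
      refine intervalIntegral.norm_integral_le_of_norm_le_const fun x hx => ?_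
      rw [Set.uIoc_of_le hab.le] at hx
      rw [norm_mul, Real.norm_eq_abs, Real.norm_eq_abs]
      have h1 := hT0 x ⟨hx.1.le, hx.2⟩
      have h2 : |v.eval x| ≤ 1 := by
        rw [hve, abs_pow]
        refine pow_le_one₀ (abs_nonneg _) ?_
        rw [show 2 / (b - a) * x + -(a + b) / (b - a) = (2 * x - (a + b)) / (b - a) by ring,
          abs_div, abs_of_pos hh, div_le_one hh, abs_le]
        constructor <;> linarith [hx.1, hx.2]
      calc _ ≤ (M * (b - a) ^ (k + 2)) * 1 := mul_le_mul h1 h2 (abs_nonneg _) hB0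
        _ = _ := mul_one _
    rw [Real.norm_eq_abs, abs_of_pos hh] at hb
    rw [abs_of_pos (by positivity)]
    calc _ ≤ ((b - a) / 2)⁻¹ * (M * (b - a) ^ (k + 2) * (b - a)) := by gcongr
      _ = B := by rw [hB]; field_simp
  have hr' : (2 * r - (a + b)) / (b - a) ∈ Set.Ioo (-1:ℝ) 1 := by
    constructor
    · rw [lt_div_iff₀ hh]; linarith [hr.1]
    · rw [div_lt_one hh]; linarith [hr.2]
  have hfin := hcore p hpd B hp1 hpm _ hr' hroot
  have hder : p.derivative.eval ((2 * r - (a + b)) / (b - a)) =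
      (b - a) / 2 * (P - T).derivative.eval r := by
    have : (b - a) / 2 * ((2 * r - (a + b)) / (b - a)) + (a + b) / 2 = r := by
      field_simp; ring
    rw [hp, Polynomial.derivative_comp, Polynomial.eval_mul, Polynomial.eval_comp, hℓe, this]
    simp [hℓ]
  rw [hder, abs_mul, abs_of_pos (by positivity : 0 < (b - a) / 2)] at hfin
  have hfin2 : |(P - T).derivative.eval r| ≤ 4 * K * (M * (b - a) ^ (k + 1)) := by
    have : (b - a) / 2 * |(P - T).derivative.eval r| ≤
        (b - a) / 2 * (4 * K * (M * (b - a) ^ (k + 1))) := by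
      refine hfin.trans (le_of_eq ?_)
      rw [hB]; ring
    exact le_of_mul_le_mul_left this (by positivity)
  have h1 := hT1 r ⟨hr.1.le, hr.2.le⟩
  have e : derivWithin w (Set.Icc a b) r - P.derivative.eval r =
      (derivWithin w (Set.Icc a b) r - T.derivative.eval r) - (P - T).derivative.eval r := by
    simp
  rw [e]
  refine (abs_sub _ _).trans ?_
  linarith
end
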